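/- Let N ≥ 2 and define operators on L²(𝕋) by (S_j f)(z) = m_j(z) f(z^N), where m_0,…,m_{N-1} ∈ L^∞(𝕋) are such that the N×N matrix (1/√N)(m_j(z e^{2πik/N}))_{j,k=0}^{N-1} is unitary for a.e. z ∈ 𝕋. Then S_j* S_k = δ_{jk} I and ∑_j S_j S_j* = I, i.e., the operators S_j form a representation of the Cuntz algebra O_N. -/

import Mathlib

open MeasureTheory ContinuousLinearMap AddCircle

instance : Fact (0 < (1:ℝ)) := ⟨one_pos⟩

local notation "μ𝕋" => (haarAddCircle : Measure (AddCircle (1:ℝ)))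

/-- The point `k / N` of the circle, viewed as an `N`-torsion point. -/
noncomputable def torsionPoint (N : ℕ) (k : Fin N) : AddCircle (1:ℝ) :=
  (((k : ℝ) / (N : ℝ) : ℝ) : AddCircle (1:ℝ))

lemma nsmul_torsionPoint {N : ℕ} (k : Fin N) : N • torsionPoint N k = 0 := by
  have hN : (N : ℝ) ≠ 0 := by
    have := k.pos
    positivity
  have h : N • ((k : ℝ) / (N : ℝ)) = ((k : ℤ) : ℝ) := by
    rw [nsmul_eq_mul, mul_div_cancel₀ _ hN]; simp
  rw [torsionPoint, ← AddCircle.coe_nsmul, h, AddCircle.coe_eq_zero_iff]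
  exact ⟨k, by simp⟩

lemma nsmul_add_torsionPoint {N : ℕ} (x : AddCircle (1:ℝ)) (k : Fin N) :
    N • (x + torsionPoint N k) = N • x := by
  rw [nsmul_add, nsmul_torsionPoint, add_zero]

lemma measurePreserving_nsmul_haarAddCircle {N : ℕ} (hN : N ≠ 0) :
    MeasurePreserving (fun x : AddCircle (1:ℝ) => N • x) μ𝕋 μ𝕋 := by
  simpa using Measure.measurePreserving_zsmul μ𝕋 (n := (N : ℤ)) (by exact_mod_cast hN)

lemma fourier_add_point (n : ℤ) (x y : AddCircle (1:ℝ)) :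
    fourier n (x + y) = fourier n x * fourier n y := by
  simp only [fourier_apply, smul_add, toCircle_add, Circle.coe_mul]

lemma fourier_nsmul (N : ℕ) (q : ℤ) (x : AddCircle (1:ℝ)) :
    fourier q (N • x) = fourier (N * q) x := by
  simp only [fourier_apply]
  rw [mul_comm, mul_smul, natCast_zsmul]

lemma sum_fourier_torsionPoint {N : ℕ} (n : ℤ) (hn : ¬ (N : ℤ) ∣ n) :
    ∑ k : Fin N, fourier n (torsionPoint N k) = 0 := by
  rcases Nat.eq_zero_or_pos N with rfl | hN
  · simp
  have hN0 : (N : ℂ) ≠ 0 := by exact_mod_cast hN.ne'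
  set ζ : ℂ := Complex.exp (2 * Real.pi * Complex.I * n / N) with hζ
  have hpow (k : Fin N) : fourier n (torsionPoint N k) = ζ ^ (k : ℕ) := by
    rw [torsionPoint, fourier_coe_apply, hζ, ← Complex.exp_nat_mul]
    congr 1
    push_cast
    ring
  have hζ1 : ζ ≠ 1 := by
    rw [hζ, Ne, Complex.exp_eq_one_iff]
    rintro ⟨q, hq⟩
    refine hn ⟨q, ?_⟩
    have h2 : (2 * Real.pi * Complex.I : ℂ) ≠ 0 := Complex.two_pi_I_ne_zero
    rw [div_eq_iff hN0, mul_comm (q : ℂ), mul_assoc _ (q : ℂ)] at hq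
    have := mul_left_cancel₀ h2 hq
    rw [mul_comm]
    exact_mod_cast this
  have hζN : ζ ^ N = 1 := by
    rw [hζ, ← Complex.exp_nat_mul, Complex.exp_eq_one_iff]
    exact ⟨n, by field_simp⟩
  simp_rw [hpow]
  rw [Fin.sum_univ_eq_sum_range (fun i => ζ ^ i), geom_sum_eq hζ1, hζN]
  simp

lemma ae_forall_add_torsionPoint {N : ℕ} {p : AddCircle (1:ℝ) → Prop} (hp : ∀ᵐ x ∂μ𝕋, p x) :
    ∀ᵐ x ∂μ𝕋, ∀ k : Fin N, p (x + torsionPoint N k) :=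
  ae_all_iff.2 fun k =>
    (measurePreserving_add_right μ𝕋 (torsionPoint N k)).quasiMeasurePreserving.ae hp

lemma integral_sum_add_torsionPoint {N : ℕ} {g : AddCircle (1:ℝ) → ℂ} (hg : Integrable g μ𝕋) :
    ∫ x, ∑ k : Fin N, g (x + torsionPoint N k) ∂μ𝕋 = N * ∫ x, g x ∂μ𝕋 := by
  rw [integral_finsetSum _ fun k _ => hg.comp_add_right (torsionPoint N k)]
  simp [integral_add_right_eq_self]

lemma Lp_eq_zero_of_fourierCoeff_eq_zero {v : AddCircle (1:ℝ) → ℂ} (hv : MemLp v 2 μ𝕋)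
    (h : ∀ n, fourierCoeff v n = 0) : v =ᵐ[μ𝕋] 0 := by
  have h0 : hv.toLp v = 0 := by
    apply (fourierBasis (T := (1:ℝ))).repr.injective
    ext n
    rw [fourierBasis_repr, fourierCoeff_congr_ae hv.coeFn_toLp, h n]
    simp
  exact (MemLp.toLp_eq_toLp_iff hv MemLp.zero).1 (by rw [h0]; simp)

/-- A square-integrable function orthogonal to all `e_{Nq}` has vanishing average over the
cosets of the `N`-torsion subgroup. -/
lemma sum_add_torsionPoint_ae_eq_zero {N : ℕ} {u : AddCircle (1:ℝ) → ℂ} (hu : MemLp u 2 μ𝕋)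
    (h : ∀ q : ℤ, fourierCoeff u (N * q) = 0) :
    ∀ᵐ x ∂μ𝕋, ∑ k : Fin N, u (x + torsionPoint N k) = 0 := by
  have hk (k : Fin N) : MemLp (fun x => u (x + torsionPoint N k)) 2 μ𝕋 :=
    hu.comp_measurePreserving (measurePreserving_add_right μ𝕋 (torsionPoint N k))
  refine Lp_eq_zero_of_fourierCoeff_eq_zero
    (v := fun x => ∑ k : Fin N, u (x + torsionPoint N k))
    (memLp_finsetSum _ fun k _ => hk k) fun n => ?_
  have hcoeff (k : Fin N) : fourierCoeff (fun x => u (x + torsionPoint N k)) n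
      = fourier n (torsionPoint N k) * fourierCoeff u n := by
    have h1 (x : AddCircle (1:ℝ)) : fourier (-n) x • u (x + torsionPoint N k)
        = fourier n (torsionPoint N k) *
          (fourier (-n) (x + torsionPoint N k) • u (x + torsionPoint N k)) := by
      have h2 : fourier n (torsionPoint N k) * fourier (-n) (torsionPoint N k) = 1 := by
        rw [← fourier_add]; simp
      rw [fourier_add_point, smul_eq_mul, smul_eq_mul]
      linear_combination (-fourier (-n) x * u (x + torsionPoint N k)) * h2
    simp_rw [fourierCoeff, h1]
    rw [integral_const_mul,
      integral_add_right_eq_self (fun x => fourier (-n) x • u x) (torsionPoint N k)]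
  have hsum : fourierCoeff (fun x => ∑ k : Fin N, u (x + torsionPoint N k)) n
      = ∑ k : Fin N, fourierCoeff (fun x => u (x + torsionPoint N k)) n := by
    have := fourierCoeff.sum Finset.univ (fun (k : Fin N) x => u (x + torsionPoint N k))
      (fun k _ => (hk k).integrable (by norm_num))
    convert congrFun this n using 1
    · congr 1; ext x; simp
    · simp
  rw [hsum]
  simp_rw [hcoeff, ← Finset.sum_mul]
  by_cases hn : (N : ℤ) ∣ n
  · obtain ⟨q, rfl⟩ := hn
    rw [h, mul_zero]
  · rw [sum_fourier_torsionPoint n hn, zero_mul]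

section Filter

variable {N : ℕ} {m : Fin N → AddCircle (1:ℝ) → ℂ} {x : AddCircle (1:ℝ)}

lemma sum_filter_row (hN : N ≠ 0)
    (h : (Matrix.of fun j k : Fin N => ((Real.sqrt N : ℂ))⁻¹ * m j (x + torsionPoint N k))
        ∈ Matrix.unitaryGroup (Fin N) ℂ) (i j : Fin N) :
    ∑ k, m i (x + torsionPoint N k) * star (m j (x + torsionPoint N k))
      = if i = j then (N : ℂ) else 0 := by
  have hs : (Real.sqrt N : ℂ) * Real.sqrt N = N := by
    rw [← Complex.ofReal_mul, Real.mul_self_sqrt (by positivity)]; simp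
  have hs0 : (Real.sqrt N : ℂ) ≠ 0 := by
    intro h0; rw [h0, zero_mul] at hs; exact hN (by exact_mod_cast hs.symm)
  have := congrFun (congrFun (Matrix.mem_unitaryGroup_iff.1 h) i) j
  rw [Matrix.mul_apply, Matrix.one_apply] at this
  simp only [Matrix.star_apply, Matrix.of_apply, star_mul', star_inv₀, Complex.star_def,
    Complex.conj_ofReal] at this
  calc _ = (Real.sqrt N : ℂ) * Real.sqrt N * ∑ k, (Real.sqrt N : ℂ)⁻¹ *
        m i (x + torsionPoint N k) * ((Real.sqrt N : ℂ)⁻¹ * star (m j (x + torsionPoint N k))) := by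
        rw [Finset.mul_sum]
        refine Finset.sum_congr rfl fun k _ => ?_
        field_simp
    _ = _ := by
        simp only [Complex.star_def]
        rw [this, hs]; simp

lemma sum_filter_column (hN : N ≠ 0)
    (h : (Matrix.of fun j k : Fin N => ((Real.sqrt N : ℂ))⁻¹ * m j (x + torsionPoint N k))
        ∈ Matrix.unitaryGroup (Fin N) ℂ) (k l : Fin N) :
    ∑ j, star (m j (x + torsionPoint N k)) * m j (x + torsionPoint N l)
      = if k = l then (N : ℂ) else 0 := by
  have hs : (Real.sqrt N : ℂ) * Real.sqrt N = N := by
    rw [← Complex.ofReal_mul, Real.mul_self_sqrt (by positivity)]; simp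
  have hs0 : (Real.sqrt N : ℂ) ≠ 0 := by
    intro h0; rw [h0, zero_mul] at hs; exact hN (by exact_mod_cast hs.symm)
  have := congrFun (congrFun (Matrix.mem_unitaryGroup_iff'.1 h) k) l
  rw [Matrix.mul_apply, Matrix.one_apply] at this
  simp only [Matrix.star_apply, Matrix.of_apply, star_mul', star_inv₀, Complex.star_def,
    Complex.conj_ofReal] at this
  calc _ = (Real.sqrt N : ℂ) * Real.sqrt N * ∑ j, (Real.sqrt N : ℂ)⁻¹ *
        star (m j (x + torsionPoint N k)) * ((Real.sqrt N : ℂ)⁻¹ * m j (x + torsionPoint N l)) := by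
        rw [Finset.mul_sum]
        refine Finset.sum_congr rfl fun k _ => ?_
        field_simp
    _ = _ := by
        simp only [Complex.star_def]
        rw [this, hs]; simp

lemma torsionPoint_zero (hN : 0 < N) : torsionPoint N ⟨0, hN⟩ = 0 := by
  simp [torsionPoint]

lemma norm_filter_le (hN : 0 < N)
    (h : (Matrix.of fun j k : Fin N => ((Real.sqrt N : ℂ))⁻¹ * m j (x + torsionPoint N k))
        ∈ Matrix.unitaryGroup (Fin N) ℂ) (j : Fin N) :
    ‖m j x‖ ≤ Real.sqrt N := by
  have h1 := entry_norm_bound_of_unitary h j ⟨0, hN⟩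
  have h0 : (0:ℝ) < Real.sqrt N := Real.sqrt_pos.2 (by exact_mod_cast hN)
  rw [Matrix.of_apply, torsionPoint_zero, add_zero, norm_mul, norm_inv, Complex.norm_real,
    Real.norm_of_nonneg h0.le, inv_mul_le_iff₀ h0, mul_one] at h1
  exact h1

end Filter

section CuntzIsometries

variable {N : ℕ} {m : Fin N → AddCircle (1:ℝ) → ℂ} {S : Fin N → Lp ℂ 2 μ𝕋 →L[ℂ] Lp ℂ 2 μ𝕋}

lemma inner_filterOperator (hN : N ≠ 0)
    (hunit : ∀ᵐ x ∂μ𝕋,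
      (Matrix.of fun j k : Fin N => ((Real.sqrt N : ℂ))⁻¹ * m j (x + torsionPoint N k))
        ∈ Matrix.unitaryGroup (Fin N) ℂ)
    (hS : ∀ (j : Fin N) (f : Lp ℂ 2 μ𝕋), S j f =ᵐ[μ𝕋] fun x => m j x * f (N • x))
    (j k : Fin N) (f g : Lp ℂ 2 μ𝕋) :
    inner ℂ (S j f) (S k g) = if k = j then inner ℂ f g else 0 := by
  have hN' : (N : ℂ) ≠ 0 := by exact_mod_cast hN
  set G : AddCircle (1:ℝ) → ℂ := fun x => m k x * g (N • x) * star (m j x * f (N • x)) with hG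
  have hGae : (fun x => inner ℂ (S j f x) (S k g x)) =ᵐ[μ𝕋] G := by
    filter_upwards [hS j f, hS k g] with x h1 h2
    rw [h1, h2, RCLike.inner_apply]; rfl
  have hGint : Integrable G μ𝕋 := (L2.integrable_inner (S j f) (S k g)).congr hGae
  have hsum : ∫ x, ∑ l : Fin N, G (x + torsionPoint N l) ∂μ𝕋
      = ∫ x, (if k = j then (N : ℂ) else 0) * inner ℂ (f (N • x)) (g (N • x)) ∂μ𝕋 := by
    refine integral_congr_ae ?_
    filter_upwards [hunit] with x hx
    rw [← sum_filter_row hN hx k j, Finset.sum_mul]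
    refine Finset.sum_congr rfl fun l _ => ?_
    simp only [hG, nsmul_add_torsionPoint, RCLike.inner_apply, star_mul', Complex.star_def]
    ring
  have hmp := measurePreserving_nsmul_haarAddCircle hN
  have hcomp : ∫ x, inner ℂ (f (N • x)) (g (N • x)) ∂μ𝕋 = inner ℂ f g := by
    have := integral_map hmp.measurable.aemeasurable (f := fun x => inner ℂ (f x) (g x))
      (by rw [hmp.map_eq]; exact (L2.integrable_inner f g).1)
    rw [L2.inner_def, ← this, hmp.map_eq]
  rw [integral_sum_add_torsionPoint hGint, integral_const_mul, hcomp] at hsum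
  rw [L2.inner_def, integral_congr_ae hGae]
  apply mul_left_cancel₀ hN'
  rw [hsum]
  split_ifs <;> simp

lemma filterOperator_fourierLp (hN : N ≠ 0)
    (hS : ∀ (j : Fin N) (f : Lp ℂ 2 μ𝕋), S j f =ᵐ[μ𝕋] fun x => m j x * f (N • x))
    (j : Fin N) (q : ℤ) :
    S j (fourierLp 2 q) =ᵐ[μ𝕋] fun x => m j x * fourier (N * q) x := by
  filter_upwards [hS j (fourierLp 2 q),
    (measurePreserving_nsmul_haarAddCircle hN).quasiMeasurePreserving.ae
      (coeFn_fourierLp 2 q)] with x h1 h2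
  rw [h1, h2, fourier_nsmul]

lemma aestronglyMeasurable_filter (hN : N ≠ 0)
    (hS : ∀ (j : Fin N) (f : Lp ℂ 2 μ𝕋), S j f =ᵐ[μ𝕋] fun x => m j x * f (N • x))
    (j : Fin N) : AEStronglyMeasurable (m j) μ𝕋 := by
  refine (Lp.aestronglyMeasurable (S j (fourierLp 2 0))).congr ?_
  filter_upwards [filterOperator_fourierLp hN hS j 0] with x hx
  rw [hx]; simp

lemma memLp_star_filter_mul (hN : 0 < N)
    (hunit : ∀ᵐ x ∂μ𝕋,
      (Matrix.of fun j k : Fin N => ((Real.sqrt N : ℂ))⁻¹ * m j (x + torsionPoint N k))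
        ∈ Matrix.unitaryGroup (Fin N) ℂ)
    (hS : ∀ (j : Fin N) (f : Lp ℂ 2 μ𝕋), S j f =ᵐ[μ𝕋] fun x => m j x * f (N • x))
    (j : Fin N) (f : Lp ℂ 2 μ𝕋) : MemLp (fun x => star (m j x) * f x) 2 μ𝕋 := by
  refine (Lp.memLp f).of_le_mul (c := Real.sqrt N)
    ((aestronglyMeasurable_filter hN.ne' hS j).star.mul (Lp.aestronglyMeasurable f)) ?_
  filter_upwards [hunit] with x hx
  rw [norm_mul, norm_star]
  gcongr
  exact norm_filter_le hN hx j

lemma fourierCoeff_star_filter_mul (hN : N ≠ 0)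
    (hS : ∀ (j : Fin N) (f : Lp ℂ 2 μ𝕋), S j f =ᵐ[μ𝕋] fun x => m j x * f (N • x))
    (j : Fin N) (f : Lp ℂ 2 μ𝕋) (q : ℤ) :
    fourierCoeff (fun x => star (m j x) * f x) (N * q)
      = inner ℂ (fourierLp 2 q) (adjoint (S j) f) := by
  rw [adjoint_inner_right, L2.inner_def, fourierCoeff]
  refine integral_congr_ae ?_
  filter_upwards [filterOperator_fourierLp hN hS j q] with x hx
  rw [hx, fourier_neg, RCLike.inner_apply, map_mul, smul_eq_mul, Complex.star_def]
  ring

lemma eq_zero_of_sum_star_filter_mul_eq_zero (hN : 0 < N) {x : AddCircle (1:ℝ)}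
    (hU : (Matrix.of fun j k : Fin N => ((Real.sqrt N : ℂ))⁻¹ * m j (x + torsionPoint N k))
        ∈ Matrix.unitaryGroup (Fin N) ℂ) {f : AddCircle (1:ℝ) → ℂ}
    (hx : ∀ j, ∑ k : Fin N, star (m j (x + torsionPoint N k)) * f (x + torsionPoint N k) = 0) :
    f x = 0 := by
  have h2 : ∑ k : Fin N, (∑ j, star (m j (x + torsionPoint N k)) *
      m j (x + torsionPoint N ⟨0, hN⟩)) * f (x + torsionPoint N k) = 0 := by
    simp_rw [Finset.sum_mul]
    rw [Finset.sum_comm]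
    refine Finset.sum_eq_zero fun j _ => ?_
    rw [← mul_zero (m j (x + torsionPoint N ⟨0, hN⟩)), ← hx j, Finset.mul_sum]
    exact Finset.sum_congr rfl fun k _ => by ring
  simp_rw [sum_filter_column hN.ne' hU] at h2
  simpa [torsionPoint_zero, hN.ne'] using h2

lemma eq_zero_of_adjoint_filterOperator_eq_zero (hN : 0 < N)
    (hunit : ∀ᵐ x ∂μ𝕋,
      (Matrix.of fun j k : Fin N => ((Real.sqrt N : ℂ))⁻¹ * m j (x + torsionPoint N k))
        ∈ Matrix.unitaryGroup (Fin N) ℂ)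
    (hS : ∀ (j : Fin N) (f : Lp ℂ 2 μ𝕋), S j f =ᵐ[μ𝕋] fun x => m j x * f (N • x))
    (f : Lp ℂ 2 μ𝕋) (hf : ∀ j, adjoint (S j) f = 0) : f = 0 := by
  have hall : ∀ᵐ x ∂μ𝕋, ∀ j, ∑ k : Fin N,
      star (m j (x + torsionPoint N k)) * f (x + torsionPoint N k) = 0 :=
    ae_all_iff.2 fun j => sum_add_torsionPoint_ae_eq_zero
      (u := fun x => star (m j x) * f x) (memLp_star_filter_mul hN hunit hS j f)
      fun q => (fourierCoeff_star_filter_mul hN.ne' hS j f q).trans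
        (by rw [hf j, inner_zero_right])
  refine Lp.eq_zero_iff_ae_eq_zero.2 ?_
  filter_upwards [hall, hunit] with x hx hU
  exact eq_zero_of_sum_star_filter_mul_eq_zero hN hU hx

end CuntzIsometries

theorem stmt1 (N : ℕ) (hN : 2 ≤ N)
    (m : Fin N → AddCircle (1:ℝ) → ℂ)
    (hunit : ∀ᵐ x ∂(haarAddCircle : Measure (AddCircle (1:ℝ))),
      (Matrix.of fun j k : Fin N =>
          ((Real.sqrt N : ℂ))⁻¹ * m j (x + (((k : ℝ) / (N : ℝ) : ℝ) : AddCircle (1:ℝ))))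
        ∈ Matrix.unitaryGroup (Fin N) ℂ)
    (S : Fin N →
      Lp ℂ 2 (haarAddCircle : Measure (AddCircle (1:ℝ))) →L[ℂ]
        Lp ℂ 2 (haarAddCircle : Measure (AddCircle (1:ℝ))))
    (hS : ∀ (j : Fin N) (f : Lp ℂ 2 (haarAddCircle : Measure (AddCircle (1:ℝ)))),
      (S j f : AddCircle (1:ℝ) → ℂ) =ᵐ[haarAddCircle] fun x => m j x * f (N • x)) :
    (∀ j k : Fin N,
      (adjoint (S j)) ∘L (S k) =
        if j = k then
          (1 : Lp ℂ 2 (haarAddCircle : Measure (AddCircle (1:ℝ))) →L[ℂ]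
            Lp ℂ 2 (haarAddCircle : Measure (AddCircle (1:ℝ))))
        else 0) ∧
    ∑ j : Fin N, (S j) ∘L (adjoint (S j)) = 1 := by
  have hN0 : 0 < N := by omega
  have hiso (j k : Fin N) : (adjoint (S j)) ∘L (S k) = if j = k then 1 else 0 := by
    refine ContinuousLinearMap.ext fun g => ext_inner_left ℂ fun f => ?_
    rw [comp_apply, adjoint_inner_right, inner_filterOperator hN0.ne' hunit hS]
    rcases eq_or_ne j k with rfl | h
    · simp
    · simp [h, h.symm]
  refine ⟨hiso, ContinuousLinearMap.ext fun f => ?_⟩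
  refine sub_eq_zero.1 (eq_zero_of_adjoint_filterOperator_eq_zero hN0 hunit hS _ fun i => ?_)
  have happ (j : Fin N) (g : Lp ℂ 2 (haarAddCircle : Measure (AddCircle (1:ℝ)))) :
      adjoint (S i) (S j g) = if i = j then g else 0 := by
    rw [← comp_apply, hiso]
    split_ifs <;> simp
  simp [sum_apply, happ]
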